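/- arXiv:1310.7063 — 4 statements merged into one kernel-verified Lean document; each statement's English description precedes it below -/
import Mathlib

section
/- Under the stepsize condition α ≤ (1 + λ_n(W))/L_h and β < 1, the Lyapunov function is nonincreasing along the decentralized gradient descent iterates: ξ_α([x_{(i)}(k+1)]) ≤ ξ_α([x_{(i)}(k)]) for all k ≥ 0. -/
open scoped RealInnerProductSpace

theorem descent_aux {E : Type*} [NormedAddCommGroup E] [InnerProductSpace ℝ E] [CompleteSpace E]
    (f : E → ℝ) (g : E → E) (L : ℝ) (hL : 0 < L)
    (hg : ∀ z, HasGradientAt f (g z) z) (hl : LipschitzWith L.toNNReal g) (x d : E) :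
    f (x + d) ≤ f x + ⟪g x, d⟫ + L / 2 * ‖d‖ ^ 2 := by
  have hder : ∀ t : ℝ, HasDerivAt (fun t : ℝ => f (x + t • d) - t * ⟪g x, d⟫ - L / 2 * ‖d‖ ^ 2 * t ^ 2)
      (⟪g (x + t • d), d⟫ - ⟪g x, d⟫ - L * ‖d‖ ^ 2 * t) t := by
    intro t
    have h1 : HasDerivAt (fun t : ℝ => x + t • d) d t := by
      simpa using ((hasDerivAt_id t).smul_const d).const_add x
    have h2 : HasDerivAt (fun t : ℝ => f (x + t • d)) ⟪g (x + t • d), d⟫ t := by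
      have := (hg (x + t • d)).hasFDerivAt.comp_hasDerivAt t h1
      rw [InnerProductSpace.toDual_apply_apply] at this
      exact this
    have h3 : HasDerivAt (fun t : ℝ => t * ⟪g x, d⟫) ⟪g x, d⟫ t := by
      simpa using (hasDerivAt_id t).mul_const ⟪g x, d⟫
    have h4 : HasDerivAt (fun t : ℝ => L / 2 * ‖d‖ ^ 2 * t ^ 2) (L * ‖d‖ ^ 2 * t) t := by
      have := (hasDerivAt_pow 2 t).const_mul (L / 2 * ‖d‖ ^ 2)
      refine this.congr_deriv ?_
      simp
      ring
    exact (h2.sub h3).sub h4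
  have hanti : AntitoneOn (fun t : ℝ => f (x + t • d) - t * ⟪g x, d⟫ - L / 2 * ‖d‖ ^ 2 * t ^ 2)
      (Set.Icc 0 1) := by
    refine antitoneOn_of_hasDerivWithinAt_nonpos (convex_Icc 0 1)
      (fun t _ => (hder t).continuousAt.continuousWithinAt)
      (fun t _ => (hder t).hasDerivWithinAt) ?_
    intro t ht
    rw [interior_Icc] at ht
    have h1 : ⟪g (x + t • d) - g x, d⟫ ≤ ‖g (x + t • d) - g x‖ * ‖d‖ := real_inner_le_norm _ _
    have h2 : ‖g (x + t • d) - g x‖ ≤ L * (t * ‖d‖) := by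
      have := hl.norm_sub_le (x + t • d) x
      rw [add_sub_cancel_left, norm_smul, Real.norm_of_nonneg ht.1.le,
        Real.coe_toNNReal _ hL.le] at this
      exact this
    have h3 := mul_le_mul_of_nonneg_right h2 (norm_nonneg d)
    rw [inner_sub_left] at h1
    nlinarith
  have := hanti (Set.left_mem_Icc.2 zero_le_one) (Set.right_mem_Icc.2 zero_le_one) zero_le_one
  simp at this
  linarith

theorem quad_aux {n p : ℕ} (W : Matrix (Fin n) (Fin n) ℝ) (hW : W.IsHermitian) (l : ℝ)
    (hl : ∀ i, l ≤ hW.eigenvalues i) (d : Fin n → EuclideanSpace ℝ (Fin p)) :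
    l * ∑ i, ‖d i‖ ^ 2 ≤ ∑ i, ∑ j, W i j * ⟪d i, d j⟫ := by
  have hps : (W - algebraMap ℝ (Matrix (Fin n) (Fin n) ℝ) l).PosSemidef := by
    rw [Matrix.posSemidef_iff_isHermitian_and_spectrum_nonneg]
    refine ⟨hW.sub ?_, ?_⟩
    · rw [Matrix.algebraMap_eq_diagonal]
      exact Matrix.isHermitian_diagonal _
    · rw [← spectrum.sub_singleton_eq, hW.spectrum_real_eq_range_eigenvalues]
      rintro _ ⟨_, ⟨i, rfl⟩, _, rfl, rfl⟩
      simpa using hl i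
  have hv : ∀ v : Fin n → ℝ, l * ∑ i, v i ^ 2 ≤ ∑ i, ∑ j, W i j * (v i * v j) := by
    intro v
    have h := hps.dotProduct_mulVec_nonneg v
    rw [Matrix.sub_mulVec, dotProduct_sub, Algebra.algebraMap_eq_smul_one, Matrix.smul_mulVec,
      Matrix.one_mulVec, dotProduct_smul] at h
    simp only [dotProduct, Matrix.mulVec, star_trivial, smul_eq_mul, Finset.mul_sum] at h
    rw [Finset.mul_sum]
    have e1 : ∀ i, l * v i ^ 2 = l * (v i * v i) := fun i => by ring
    have e2 : ∀ i j, W i j * (v i * v j) = v i * (W i j * v j) := fun i j => by ring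
    simp only [e1, e2]
    linarith
  have e3 : ∀ i j, ⟪d i, d j⟫ = ∑ c, d i c * d j c := by
    intro i j
    simp [PiLp.inner_apply, mul_comm]
  have e4 : ∀ i, ‖d i‖ ^ 2 = ∑ c, d i c ^ 2 := by
    intro i
    simp [EuclideanSpace.norm_sq_eq]
  simp only [e3, e4]
  calc l * ∑ i, ∑ c, d i c ^ 2 = ∑ c, l * ∑ i, d i c ^ 2 := by
        rw [Finset.sum_comm, Finset.mul_sum]
    _ ≤ ∑ c, ∑ i, ∑ j, W i j * (d i c * d j c) := Finset.sum_le_sum fun c _ => hv fun i => d i c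
    _ = _ := by
        rw [Finset.sum_comm]
        refine Finset.sum_congr rfl fun i _ => ?_
        rw [Finset.sum_comm]
        simp only [Finset.mul_sum]

theorem lyapunov_nonincreasing
    {n p : ℕ} (hn : 0 < n)
    (f : Fin n → EuclideanSpace ℝ (Fin p) → ℝ)
    (gf : Fin n → EuclideanSpace ℝ (Fin p) → EuclideanSpace ℝ (Fin p))
    (Lf : Fin n → ℝ) (hLfpos : ∀ i, 0 < Lf i)
    (hconv : ∀ i, ConvexOn ℝ Set.univ (f i))
    (hbdd : ∀ i, BddBelow (Set.range (f i)))
    (hgrad : ∀ i z, HasGradientAt (f i) (gf i z) z)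
    (hlip : ∀ i, LipschitzWith (Lf i).toNNReal (gf i))
    (Lh : ℝ) (hLh : Lh = ⨆ i, Lf i)
    (W : Matrix (Fin n) (Fin n) ℝ)
    (hWsymm : W.IsHermitian)
    (hWnonneg : ∀ i j, 0 ≤ W i j)
    (hWrow : ∀ i, ∑ j, W i j = 1)
    (hWcol : ∀ j, ∑ i, W i j = 1)
    (lam : Fin n → ℝ) (hlamAnti : Antitone lam)
    (hlamEig : ∃ σ : Equiv.Perm (Fin n), lam = hWsymm.eigenvalues ∘ σ)
    (hlam1 : lam ⟨0, hn⟩ = 1)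
    (lamN : ℝ) (hlamN : lamN = lam ⟨n - 1, Nat.sub_lt hn Nat.one_pos⟩)
    (hlamNlb : -1 ≤ lamN)
    (β : ℝ) (hβdef : β = ⨆ j : {j : Fin n // j ≠ (⟨0, hn⟩ : Fin n)}, |lam j.1|)
    (α : ℝ) (hα : 0 < α)
    (x : ℕ → Fin n → EuclideanSpace ℝ (Fin p))
    (hiter : ∀ k i, x (k + 1) i = (∑ j, W i j • x k j) - α • gf i (x k i))
    (hx0 : ∀ i, x 0 i = 0)
    (ξ : (Fin n → EuclideanSpace ℝ (Fin p)) → ℝ)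
    (hξ : ∀ y, ξ y = -(1/2) * (∑ i, ∑ j, W i j * ⟪y i, y j⟫)
        + ∑ i, ((1/2) * ‖y i‖ ^ 2 + α * f i (y i)))
    (hstep : α ≤ (1 + lamN) / Lh)
    (hβlt : β < 1)
 :
    ∀ k, ξ (x (k + 1)) ≤ ξ (x k) := by
  intro k
  obtain ⟨σ, hσ⟩ := hlamEig
  have hl : ∀ i, lamN ≤ hWsymm.eigenvalues i := by
    intro i
    have : hWsymm.eigenvalues i = lam (σ.symm i) := by simp [hσ]
    rw [this, hlamN]
    apply hlamAnti
    rw [Fin.le_def]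
    have := (σ.symm i).2
    simp only
    omega
  have hLle : ∀ i, Lf i ≤ Lh := fun i => hLh ▸ le_ciSup (Set.finite_range Lf).bddAbove i
  have hLhpos : 0 < Lh := (hLfpos ⟨0, hn⟩).trans_le (hLle _)
  have hst : α * Lh ≤ 1 + lamN := (le_div_iff₀ hLhpos).1 hstep
  have hst' : ∀ i, α * Lf i ≤ 1 + lamN := fun i =>
    (mul_le_mul_of_nonneg_left (hLle i) hα.le).trans hst
  obtain ⟨d, hd⟩ : ∃ d : Fin n → EuclideanSpace ℝ (Fin p), ∀ i, x (k + 1) i = x k i + d i :=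
    ⟨fun i => x (k + 1) i - x k i, fun i => by simp⟩
  have hag : ∀ i, α • gf i (x k i) = (∑ j, W i j • x k j) - (x k i + d i) := by
    intro i
    rw [← hd, hiter]
    abel
  have hq := quad_aux W hWsymm lamN hl d
  have hterm : ∀ i, (1/2) * ‖x k i + d i‖ ^ 2 + α * f i (x k i + d i) ≤
      ((1/2) * ‖x k i‖ ^ 2 + α * f i (x k i)) +
        (∑ j, W i j * ⟪d i, x k j⟫ + lamN / 2 * ‖d i‖ ^ 2) := by
    intro i
    have h1 := mul_le_mul_of_nonneg_left
      (descent_aux (f i) (gf i) (Lf i) (hLfpos i) (hgrad i) (hlip i) (x k i) (d i)) hα.le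
    have h2 : α * ⟪gf i (x k i), d i⟫ =
        ∑ j, W i j * ⟪d i, x k j⟫ - ⟪x k i, d i⟫ - ‖d i‖ ^ 2 := by
      rw [← real_inner_smul_left, hag, inner_sub_left, inner_add_left, sum_inner,
        real_inner_self_eq_norm_sq]
      have e : ∀ j, ⟪W i j • x k j, d i⟫ = W i j * ⟪d i, x k j⟫ := fun j => by
        rw [real_inner_smul_left, real_inner_comm]
      simp only [e]
      ring
    have h3 := norm_add_sq_real (x k i) (d i)
    have h4 := mul_le_mul_of_nonneg_right (hst' i) (sq_nonneg ‖d i‖)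
    rw [h3]
    nlinarith
  have hsum := Finset.sum_le_sum (s := Finset.univ) fun i _ => hterm i
  rw [Finset.sum_add_distrib (f := fun i => (1/2) * ‖x k i‖ ^ 2 + α * f i (x k i)),
    Finset.sum_add_distrib (f := fun i => ∑ j, W i j * ⟪d i, x k j⟫), ← Finset.mul_sum] at hsum
  have hsymm : ∑ i, ∑ j, W i j * ⟪x k i, d j⟫ = ∑ i, ∑ j, W i j * ⟪d i, x k j⟫ := by
    rw [Finset.sum_comm]
    refine Finset.sum_congr rfl fun i _ => Finset.sum_congr rfl fun j _ => ?_
    rw [real_inner_comm, show W j i = W i j by simpa using hWsymm.apply i j]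
  have hexp : ∑ i, ∑ j, W i j * ⟪x k i + d i, x k j + d j⟫ =
      ∑ i, ∑ j, W i j * ⟪x k i, x k j⟫ + 2 * ∑ i, ∑ j, W i j * ⟪d i, x k j⟫
        + ∑ i, ∑ j, W i j * ⟪d i, d j⟫ := by
    simp only [inner_add_left, inner_add_right, mul_add, Finset.sum_add_distrib]
    rw [hsymm]
    ring
  rw [hξ, hξ]
  simp only [hd]
  rw [hexp]
  linarith
end

section
/- Suppose β < 1 and the stacked gradients are uniformly bounded, ‖h(k)‖ ≤ D' for all k ≥ 0 and some D' > 0. Then for all k ≥ 0 and all i = 1,…,n, ‖∇f_i(x_{(i)}(k)) − ∇f_i(x̄(k))‖ ≤ α D' L_{f_i}/(1 − β), and consequently ‖g(k) − ḡ(k)‖ ≤ α D' L_h/(1 − β). -/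
open scoped RealInnerProductSpace

lemma aux_scalar {n : ℕ} (W : Matrix (Fin n) (Fin n) ℝ) (hW : W.IsHermitian)
    (hrow : ∀ i, ∑ j, W i j = 1) (β : ℝ) (hβ : β < 1) (i0 : Fin n)
    (hE : ∀ i, i ≠ i0 → |hW.eigenvalues i| ≤ β) (v : Fin n → ℝ) (hv : ∑ i, v i = 0) :
    ∑ i, (∑ j, W i j * v j) ^ 2 ≤ β ^ 2 * ∑ i, v i ^ 2 := by
  have hsym : ∀ i j, W i j = W j i := fun i j => by
    have := hW.apply i j
    simpa using this.symm
  set u := hW.eigenvectorBasis with hu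
  have hadj : ∀ (k : Fin n) (w : Fin n → ℝ), ⟪u k, WithLp.toLp 2 (W.mulVec w)⟫
      = hW.eigenvalues k * ⟪u k, WithLp.toLp 2 w⟫ := by
    intro k w
    have h1 := hW.mulVec_eigenvectorBasis k
    have h2 : ∀ j, ∑ i, W j i * u k i = hW.eigenvalues k * u k j := by
      intro j
      have := congrFun h1 j
      simpa [Matrix.mulVec, dotProduct] using this
    simp only [PiLp.inner_apply, Matrix.mulVec, dotProduct, RCLike.inner_apply, conj_trivial]
    calc ∑ i, (∑ j, W i j * w j) * u k i = ∑ i, ∑ j, W i j * w j * u k i := by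
          simp only [Finset.sum_mul]
      _ = ∑ j, ∑ i, W i j * w j * u k i := Finset.sum_comm
      _ = ∑ j, w j * ∑ i, W j i * u k i := by
          refine Finset.sum_congr rfl fun j _ => ?_
          rw [Finset.mul_sum]
          refine Finset.sum_congr rfl fun i _ => ?_
          rw [hsym i j]; ring
      _ = _ := by
          rw [Finset.mul_sum]
          refine Finset.sum_congr rfl fun j _ => ?_
          rw [h2]; ring
  have hone : ∀ k, k ≠ i0 → ⟪u k, WithLp.toLp 2 (fun _ : Fin n => (1 : ℝ))⟫ = 0 := by
    intro k hk
    have h1 := hadj k (fun _ => 1)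
    have h2 : W.mulVec (fun _ => 1) = fun _ => (1 : ℝ) := by
      funext i
      simp [Matrix.mulVec, dotProduct, hrow]
    rw [h2] at h1
    have h3 : hW.eigenvalues k < 1 := lt_of_le_of_lt (le_trans (le_abs_self _) (hE k hk)) hβ
    have h4 : (1 - hW.eigenvalues k) * ⟪u k, WithLp.toLp 2 (fun _ : Fin n => (1 : ℝ))⟫ = 0 := by
      linarith
    rcases mul_eq_zero.1 h4 with h | h
    · linarith
    · exact h
  have hi0 : ⟪u i0, WithLp.toLp 2 v⟫ = 0 := by
    set e : EuclideanSpace ℝ (Fin n) := WithLp.toLp 2 (fun _ : Fin n => (1 : ℝ)) with he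
    have h1 : e = ⟪u i0, e⟫ • u i0 := by
      conv_lhs => rw [← u.sum_repr' e]
      rw [Finset.sum_eq_single i0]
      · intro b _ hb
        rw [hone b hb, zero_smul]
      · simp
    have h2 : ⟪e, WithLp.toLp 2 v⟫ = 0 := by
      simp [he, PiLp.inner_apply, hv]
    have h3 : e ≠ 0 := by
      intro h
      have := congrArg (fun z : EuclideanSpace ℝ (Fin n) => z i0) h
      simp [he] at this
    rw [h1, real_inner_smul_left] at h2
    rcases mul_eq_zero.1 h2 with h | h
    · rw [h, zero_smul] at h1
      exact absurd h1 h3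
    · exact h
  have hn1 : ∀ w : Fin n → ℝ, ∑ i, w i ^ 2 = ∑ k, ⟪u k, WithLp.toLp 2 w⟫ ^ 2 := by
    intro w
    have := u.sum_sq_norm_inner_right (WithLp.toLp 2 w)
    simp only [Real.norm_eq_abs, sq_abs] at this
    rw [this, EuclideanSpace.norm_sq_eq]
    simp
  have h5 := hn1 (W.mulVec v)
  simp only [Matrix.mulVec, dotProduct] at h5
  rw [h5, hn1 v, Finset.mul_sum]
  refine Finset.sum_le_sum fun k _ => ?_
  have h6 := hadj k v
  simp only [Matrix.mulVec, dotProduct] at h6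
  rw [h6, mul_pow]
  by_cases hk : k = i0
  · rw [hk, hi0]; simp
  · refine mul_le_mul_of_nonneg_right ?_ (sq_nonneg _)
    rw [← sq_abs]
    exact pow_le_pow_left₀ (abs_nonneg _) (hE k hk) 2

lemma aux_vec {n p : ℕ} (W : Matrix (Fin n) (Fin n) ℝ) (β : ℝ)
    (h : ∀ v : Fin n → ℝ, ∑ i, v i = 0 →
      ∑ i, (∑ j, W i j * v j) ^ 2 ≤ β ^ 2 * ∑ i, v i ^ 2)
    (e : Fin n → EuclideanSpace ℝ (Fin p)) (he : ∑ i, e i = 0) :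
    ∑ i, ‖∑ j, W i j • e j‖ ^ 2 ≤ β ^ 2 * ∑ i, ‖e i‖ ^ 2 := by
  simp only [EuclideanSpace.norm_sq_eq, Real.norm_eq_abs, sq_abs]
  rw [Finset.sum_comm, Finset.sum_comm (f := fun i c => (e i) c ^ 2), Finset.mul_sum]
  refine Finset.sum_le_sum fun c _ => ?_
  have h1 := h (fun i => e i c) (by
    have := congrArg (fun z : EuclideanSpace ℝ (Fin p) => z c) he
    simpa using this)
  simpa using h1

lemma aux_center {n p : ℕ} (hn : 0 < n) (e : Fin n → EuclideanSpace ℝ (Fin p)) :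
    ∑ i, ‖e i - (n : ℝ)⁻¹ • ∑ j, e j‖ ^ 2 ≤ ∑ i, ‖e i‖ ^ 2 := by
  have hn' : (n : ℝ) ≠ 0 := by positivity
  set m := (n : ℝ)⁻¹ • ∑ j, e j with hm
  have hs : ∑ j, e j = (n : ℝ) • m := by rw [hm, smul_smul, mul_inv_cancel₀ hn', one_smul]
  have h1 : ∑ i, ‖e i - m‖ ^ 2 = ∑ i, ‖e i‖ ^ 2 - 2 * ⟪∑ i, e i, m⟫ + n * ‖m‖ ^ 2 := by
    simp only [norm_sub_sq_real, Finset.sum_add_distrib, Finset.sum_sub_distrib, sum_inner,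
      Finset.mul_sum]
    simp
  rw [h1, hs, real_inner_smul_left, real_inner_self_eq_norm_sq]
  have : 0 ≤ (n : ℝ) * ‖m‖ ^ 2 := by positivity
  linarith

theorem bounded_gradient_deviation
    {n p : ℕ} (hn : 0 < n)
    (f : Fin n → EuclideanSpace ℝ (Fin p) → ℝ)
    (gf : Fin n → EuclideanSpace ℝ (Fin p) → EuclideanSpace ℝ (Fin p))
    (Lf : Fin n → ℝ) (hLfpos : ∀ i, 0 < Lf i)
    (hconv : ∀ i, ConvexOn ℝ Set.univ (f i))
    (hbdd : ∀ i, BddBelow (Set.range (f i)))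
    (hgrad : ∀ i z, HasGradientAt (f i) (gf i z) z)
    (hlip : ∀ i, LipschitzWith (Lf i).toNNReal (gf i))
    (Lh : ℝ) (hLh : Lh = ⨆ i, Lf i)
    (W : Matrix (Fin n) (Fin n) ℝ)
    (hWsymm : W.IsHermitian)
    (hWnonneg : ∀ i j, 0 ≤ W i j)
    (hWrow : ∀ i, ∑ j, W i j = 1)
    (hWcol : ∀ j, ∑ i, W i j = 1)
    (lam : Fin n → ℝ) (hlamAnti : Antitone lam)
    (hlamEig : ∃ σ : Equiv.Perm (Fin n), lam = hWsymm.eigenvalues ∘ σ)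
    (hlam1 : lam ⟨0, hn⟩ = 1)
    (lamN : ℝ) (hlamN : lamN = lam ⟨n - 1, Nat.sub_lt hn Nat.one_pos⟩)
    (hlamNlb : -1 ≤ lamN)
    (β : ℝ) (hβdef : β = ⨆ j : {j : Fin n // j ≠ (⟨0, hn⟩ : Fin n)}, |lam j.1|)
    (α : ℝ) (hα : 0 < α)
    (x : ℕ → Fin n → EuclideanSpace ℝ (Fin p))
    (hiter : ∀ k i, x (k + 1) i = (∑ j, W i j • x k j) - α • gf i (x k i))
    (hx0 : ∀ i, x 0 i = 0)
    (hβlt : β < 1)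
    (D' : ℝ) (hD'pos : 0 < D')
    (hhbnd : ∀ k, Real.sqrt (∑ i, ‖gf i (x k i)‖ ^ 2) ≤ D')
    (xbar : ℕ → EuclideanSpace ℝ (Fin p)) (hxbar : ∀ k, xbar k = (n : ℝ)⁻¹ • ∑ i, x k i)
    (g : ℕ → EuclideanSpace ℝ (Fin p)) (hg : ∀ k, g k = (n : ℝ)⁻¹ • ∑ i, gf i (x k i))
    (gbar : ℕ → EuclideanSpace ℝ (Fin p)) (hgbar : ∀ k, gbar k = (n : ℝ)⁻¹ • ∑ i, gf i (xbar k))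
 :
    (∀ k, ∀ i, ‖gf i (x k i) - gf i (xbar k)‖ ≤ α * D' * Lf i / (1 - β))
    ∧ (∀ k, ‖g k - gbar k‖ ≤ α * D' * Lh / (1 - β)) := by
  obtain ⟨σ, hσ⟩ := hlamEig
  have hE : ∀ i, i ≠ σ ⟨0, hn⟩ → |hWsymm.eigenvalues i| ≤ β := by
    intro i hi
    have hj : σ.symm i ≠ ⟨0, hn⟩ := by
      intro h
      exact hi (by rw [← h]; simp)
    have h1 := le_ciSup (f := fun j : {j : Fin n // j ≠ (⟨0, hn⟩ : Fin n)} => |lam j.1|)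
      (Set.finite_range _).bddAbove ⟨σ.symm i, hj⟩
    rw [← hβdef] at h1
    simpa [hσ] using h1
  have hβ0 : 0 ≤ β := by
    rw [hβdef]
    exact Real.iSup_nonneg fun _ => abs_nonneg _
  have hn' : (n : ℝ) ≠ 0 := by positivity
  have h1β : 0 < 1 - β := by linarith
  have hmix := aux_vec (p := p) W β (aux_scalar W hWsymm hWrow β hβlt _ hE)
  have hbar : ∀ k, xbar (k + 1) = xbar k - α • g k := by
    intro k
    rw [hxbar, hxbar, hg]
    simp only [hiter, Finset.sum_sub_distrib]
    rw [Finset.sum_comm]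
    simp only [← Finset.sum_smul, hWcol, one_smul, ← Finset.smul_sum]
    rw [smul_sub, smul_comm]
  have hzero : ∀ k, ∑ i, (x k i - xbar k) = 0 := by
    intro k
    rw [Finset.sum_sub_distrib, hxbar]
    simp [← Nat.cast_smul_eq_nsmul ℝ, smul_smul, hn']
  have hstep : ∀ k i, x (k + 1) i - xbar (k + 1)
      = (∑ j, W i j • (x k j - xbar k)) - α • (gf i (x k i) - g k) := by
    intro k i
    rw [hbar, hiter]
    simp only [smul_sub, Finset.sum_sub_distrib, ← Finset.sum_smul, hWrow, one_smul]
    abel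
  have hnorm : ∀ e : Fin n → EuclideanSpace ℝ (Fin p),
      ‖(WithLp.toLp 2 e : PiLp 2 (fun _ : Fin n => EuclideanSpace ℝ (Fin p)))‖
        = Real.sqrt (∑ i, ‖e i‖ ^ 2) := by
    intro e
    rw [PiLp.norm_eq_of_L2]
  have hmain : ∀ k, Real.sqrt (∑ i, ‖x k i - xbar k‖ ^ 2) ≤ α * D' / (1 - β) := by
    intro k
    induction k with
    | zero =>
      have : xbar 0 = 0 := by rw [hxbar]; simp [hx0]
      simp only [hx0, this]
      simp
      positivity
    | succ k ih =>
      rw [← hnorm]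
      have hd : (WithLp.toLp 2 (fun i => x (k + 1) i - xbar (k + 1)) :
          PiLp 2 (fun _ : Fin n => EuclideanSpace ℝ (Fin p)))
          = WithLp.toLp 2 (fun i => ∑ j, W i j • (x k j - xbar k))
            - α • WithLp.toLp 2 (fun i => gf i (x k i) - g k) := by
        ext1 i
        simp only [PiLp.sub_apply, PiLp.smul_apply]
        exact hstep k i
      rw [hd]
      refine (norm_sub_le _ _).trans ?_
      rw [norm_smul, hnorm, hnorm, Real.norm_of_nonneg hα.le]
      have a1 : Real.sqrt (∑ i, ‖∑ j, W i j • (x k j - xbar k)‖ ^ 2)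
          ≤ β * Real.sqrt (∑ i, ‖x k i - xbar k‖ ^ 2) := by
        refine (Real.sqrt_le_sqrt (hmix _ (hzero k))).trans ?_
        rw [Real.sqrt_mul (sq_nonneg _), Real.sqrt_sq hβ0]
      have a2 : Real.sqrt (∑ i, ‖gf i (x k i) - g k‖ ^ 2) ≤ D' := by
        refine (Real.sqrt_le_sqrt ?_).trans (hhbnd k)
        rw [hg]
        exact aux_center hn (fun i => gf i (x k i))
      have a3 := mul_le_mul_of_nonneg_left ih hβ0
      have a4 := mul_le_mul_of_nonneg_left a2 hα.le
      have a5 : β * (α * D' / (1 - β)) + α * D' = α * D' / (1 - β) := by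
        field_simp
        ring
      linarith
  have hA : ∀ k, ∀ i, ‖gf i (x k i) - gf i (xbar k)‖ ≤ α * D' * Lf i / (1 - β) := by
    intro k i
    have h1 := (hlip i).dist_le_mul (x k i) (xbar k)
    rw [dist_eq_norm, dist_eq_norm, Real.coe_toNNReal _ (hLfpos i).le] at h1
    have h2 : ‖x k i - xbar k‖ ≤ α * D' / (1 - β) := by
      refine le_trans (Real.le_sqrt_of_sq_le ?_) (hmain k)
      exact Finset.single_le_sum (f := fun i => ‖x k i - xbar k‖ ^ 2)
        (fun _ _ => sq_nonneg _) (Finset.mem_univ i)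
    refine h1.trans ((mul_le_mul_of_nonneg_left h2 (hLfpos i).le).trans (le_of_eq ?_))
    ring
  refine ⟨hA, fun k => ?_⟩
  rw [hg, hgbar, ← smul_sub, ← Finset.sum_sub_distrib, norm_smul,
    Real.norm_of_nonneg (by positivity)]
  have h1 : ‖∑ i, (gf i (x k i) - gf i (xbar k))‖ ≤ ∑ _i : Fin n, α * D' * Lh / (1 - β) := by
    refine norm_sum_le_of_le _ fun i _ => (hA k i).trans ?_
    have h2 : Lf i ≤ Lh := by
      rw [hLh]
      exact le_ciSup (Set.finite_range _).bddAbove i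
    gcongr
  rw [Finset.sum_const, Finset.card_univ, Fintype.card_fin, nsmul_eq_mul] at h1
  rw [inv_mul_le_iff₀ (by positivity)]
  exact h1
end

section
/- Under the stepsize condition α ≤ (1 + λ_n(W))/L_h and β < 1, assuming ξ_α attains its minimum at some [x̃_{(i)}] ∈ (ℝ^p)^n and fixing any x* ∈ X*, the distance of the mean iterate to the solution set is uniformly bounded: ‖ē(k)‖ = ‖x̄(k) − Proj_{X*}(x̄(k))‖ ≤ C for all k ≥ 0, where C := (1/√n)(‖[x̃_{(i)}]‖ + ‖[x̃_{(i)} − x*]‖) and [x̃_{(i)} − x*] denotes the stacked vector with blocks x̃_{(i)} − x*. -/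
open scoped RealInnerProductSpace

section helpers
variable {E : Type*} [NormedAddCommGroup E] [InnerProductSpace ℝ E] [CompleteSpace E]

theorem aux_line (f : E → ℝ) (g : E → E) (hg : ∀ z, HasGradientAt f (g z) z) (a v : E) (t : ℝ) :
    HasDerivAt (fun t : ℝ => f (a + t • v)) ⟪g (a + t • v), v⟫ t := by
  have h1 : HasDerivAt (fun t : ℝ => a + t • v) v t := by
    simpa using ((hasDerivAt_id t).smul_const v).const_add a
  have h2 := (hg (a + t • v)).hasFDerivAt.comp_hasDerivAt t h1
  simp only [InnerProductSpace.toDual_apply_apply] at h2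
  exact h2

theorem aux_first (f : E → ℝ) (g : E → E) (hg : ∀ z, HasGradientAt f (g z) z)
    (hc : ConvexOn ℝ Set.univ f) (a b : E) : f a + ⟪g a, b - a⟫ ≤ f b := by
  have hl := aux_line f g hg a (b - a) 0
  have hconv : ConvexOn ℝ Set.univ (fun t : ℝ => f (a + t • (b - a))) := by
    refine ⟨convex_univ, ?_⟩
    intro s _ t _ c d hc0 hd0 hcd
    have := hc.2 (Set.mem_univ (a + s • (b - a))) (Set.mem_univ (a + t • (b - a))) hc0 hd0 hcd
    have e : a + (c • s + d • t) • (b - a) = c • (a + s • (b - a)) + d • (a + t • (b - a)) := by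
      have : a = (c + d) • a := by rw [hcd, one_smul]
      nth_rewrite 1 [this]
      simp only [smul_eq_mul]
      module
    simp only [e]
    exact this
  have h := hconv.le_slope_of_hasDerivAt (Set.mem_univ 0) (Set.mem_univ 1) one_pos hl
  simp [slope_def_field] at h
  linarith

theorem aux_descent (f : E → ℝ) (g : E → E) (hg : ∀ z, HasGradientAt f (g z) z)
    (L : ℝ) (hL : ∀ a b, ‖g a - g b‖ ≤ L * ‖a - b‖) (a v : E) :
    f (a + v) ≤ f a + ⟪g a, v⟫ + L / 2 * ‖v‖ ^ 2 := by
  have hd : ∀ t : ℝ, HasDerivAt (fun t : ℝ => f (a + t • v) - t * ⟪g a, v⟫ - L / 2 * ‖v‖ ^ 2 * t ^ 2)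
      (⟪g (a + t • v), v⟫ - ⟪g a, v⟫ - L * ‖v‖ ^ 2 * t) t := by
    intro t
    have h1 := aux_line f g hg a v t
    have h2 := (hasDerivAt_id t).mul_const ⟪g a, v⟫
    have h3 := ((hasDerivAt_id t).pow 2).const_mul (L / 2 * ‖v‖ ^ 2)
    refine ((h1.sub h2).sub h3).congr_deriv ?_
    simp
    ring
  have hanti : AntitoneOn (fun t : ℝ => f (a + t • v) - t * ⟪g a, v⟫ - L / 2 * ‖v‖ ^ 2 * t ^ 2)
      (Set.Ici 0) := by
    apply antitoneOn_of_deriv_nonpos (convex_Ici 0)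
    · exact fun t _ => (hd t).continuousAt.continuousWithinAt
    · exact fun t _ => (hd t).differentiableAt.differentiableWithinAt
    · intro t ht
      rw [interior_Ici, Set.mem_Ioi] at ht
      rw [(hd t).deriv, ← inner_sub_left]
      have h1 := real_inner_le_norm (g (a + t • v) - g a) v
      have h2 := hL (a + t • v) a
      rw [add_sub_cancel_left, norm_smul, Real.norm_of_nonneg ht.le] at h2
      have h3 := mul_le_mul_of_nonneg_right h2 (norm_nonneg v)
      nlinarith
  have := hanti (Set.mem_Ici.2 le_rfl) (Set.mem_Ici.2 zero_le_one) zero_le_one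
  simp at this
  linarith

theorem aux_coco (f : E → ℝ) (g : E → E) (hg : ∀ z, HasGradientAt f (g z) z)
    (hc : ConvexOn ℝ Set.univ f) (L : ℝ) (hLp : 0 < L)
    (hL : ∀ a b, ‖g a - g b‖ ≤ L * ‖a - b‖) (a b : E) :
    ‖g a - g b‖ ^ 2 ≤ L * ⟪g a - g b, a - b⟫ := by
  have key : ∀ x y : E, f x + ⟪g x, y - x⟫ + 1 / (2 * L) * ‖g y - g x‖ ^ 2 ≤ f y := by
    intro x y
    have h1 := aux_first f g hg hc x (y + (-(1 / L)) • (g y - g x))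
    have h2 := aux_descent f g hg L hL y ((-(1 / L)) • (g y - g x))
    have e : y + (-(1 / L)) • (g y - g x) - x = (y - x) + (-(1 / L)) • (g y - g x) := by abel
    rw [e, inner_add_right, inner_smul_right] at h1
    rw [norm_smul, mul_pow, inner_smul_right, Real.norm_eq_abs, sq_abs] at h2
    have h3 : ⟪g y, g y - g x⟫ - ⟪g x, g y - g x⟫ = ‖g y - g x‖ ^ 2 := by
      rw [← inner_sub_left, real_inner_self_eq_norm_sq]
    have h4 : L / 2 * ((-(1 / L)) ^ 2 * ‖g y - g x‖ ^ 2) = 1 / (2 * L) * ‖g y - g x‖ ^ 2 := by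
      field_simp
    have h5 : (1 / L) * ‖g y - g x‖ ^ 2 = 2 * (1 / (2 * L) * ‖g y - g x‖ ^ 2) := by field_simp
    rw [h4] at h2
    rw [← h3] at h5
    rw [← h3] at h2 ⊢
    linarith
  have h1 := key a b
  have h2 := key b a
  rw [norm_sub_rev (g b)] at h1
  have h3 : ⟪g a, b - a⟫ + ⟪g b, a - b⟫ = - ⟪g a - g b, a - b⟫ := by
    rw [← neg_sub a b, inner_neg_right, inner_sub_left]; ring
  have h4 : 1 / (2 * L) * ‖g a - g b‖ ^ 2 + 1 / (2 * L) * ‖g a - g b‖ ^ 2 ≤ ⟪g a - g b, a - b⟫ := by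
    linarith
  calc ‖g a - g b‖ ^ 2 = L * (1 / (2 * L) * ‖g a - g b‖ ^ 2 + 1 / (2 * L) * ‖g a - g b‖ ^ 2) := by
        field_simp; ring
    _ ≤ _ := by gcongr

end helpers

theorem aux_spec {n : ℕ} (W : Matrix (Fin n) (Fin n) ℝ) (hW : W.IsHermitian) (l : ℝ)
    (h1 : ∀ i, hW.eigenvalues i ≤ 1) (hl : ∀ i, l ≤ hW.eigenvalues i) (z : Fin n → ℝ) :
    0 ≤ ∑ i, (z i - ∑ j, W i j * z j) * z i ∧
    ∑ i, (z i - ∑ j, W i j * z j) ^ 2 ≤ (1 - l) * ∑ i, (z i - ∑ j, W i j * z j) * z i := by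
  set b := hW.eigenvectorBasis
  set Z : EuclideanSpace ℝ (Fin n) := WithLp.toLp 2 z with hZ
  set U : EuclideanSpace ℝ (Fin n) := WithLp.toLp 2 (fun i => z i - ∑ j, W i j * z j) with hU
  have hb : ∀ i, ⟪b i, U⟫ = (1 - hW.eigenvalues i) * ⟪b i, Z⟫ := by
    intro i
    have he := hW.mulVec_eigenvectorBasis i
    have hs : ∀ j k, W j k = W k j := fun j k => by
      have := hW.apply k j; simpa using this
    have e2 : ∑ j, (b i j) * ∑ k, W j k * z k = hW.eigenvalues i * ∑ j, b i j * z j := by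
      rw [Finset.mul_sum]
      simp_rw [Finset.mul_sum]
      rw [Finset.sum_comm]
      refine Finset.sum_congr rfl fun k _ => ?_
      have := congrFun he k
      simp only [Matrix.mulVec, dotProduct, Pi.smul_apply, smul_eq_mul] at this
      rw [← mul_assoc, ← this, Finset.sum_mul]
      refine Finset.sum_congr rfl fun j _ => ?_
      rw [hs j k]; ring
    simp only [PiLp.inner_apply, hU, hZ, RCLike.inner_apply, conj_trivial]
    rw [sub_mul, one_mul]
    have e3 : ∑ j, z j * b i j = ∑ j, b i j * z j := by simp_rw [mul_comm]
    rw [e3, ← e2, ← Finset.sum_sub_distrib]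
    refine Finset.sum_congr rfl fun j _ => ?_
    ring
  have e1 : ∑ i, (z i - ∑ j, W i j * z j) * z i = ∑ i, (1 - hW.eigenvalues i) * ⟪b i, Z⟫ ^ 2 := by
    have := b.sum_inner_mul_inner U Z
    have h : ⟪U, Z⟫ = ∑ i, (z i - ∑ j, W i j * z j) * z i := by
      simp [PiLp.inner_apply, hU, hZ, mul_comm]
    rw [← h, ← this]
    refine Finset.sum_congr rfl fun i _ => ?_
    rw [real_inner_comm, hb]; ring
  have e2 : ∑ i, (z i - ∑ j, W i j * z j) ^ 2 = ∑ i, (1 - hW.eigenvalues i) ^ 2 * ⟪b i, Z⟫ ^ 2 := by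
    have := b.sum_inner_mul_inner U U
    have h : ⟪U, U⟫ = ∑ i, (z i - ∑ j, W i j * z j) ^ 2 := by
      simp only [PiLp.inner_apply, hU, RCLike.inner_apply, conj_trivial, sq]
    rw [← h, ← this]
    refine Finset.sum_congr rfl fun i _ => ?_
    rw [real_inner_comm, hb]; ring
  rw [e1, e2]
  constructor
  · exact Finset.sum_nonneg fun i _ => mul_nonneg (by linarith [h1 i]) (sq_nonneg _)
  · rw [Finset.mul_sum]
    refine Finset.sum_le_sum fun i _ => ?_
    rw [← mul_assoc]
    refine mul_le_mul_of_nonneg_right ?_ (sq_nonneg _)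
    nlinarith [h1 i, hl i]

theorem aux_spec_vec {n p : ℕ} (W : Matrix (Fin n) (Fin n) ℝ) (hW : W.IsHermitian) (l : ℝ)
    (h1 : ∀ i, hW.eigenvalues i ≤ 1) (hl : ∀ i, l ≤ hW.eigenvalues i)
    (d : Fin n → EuclideanSpace ℝ (Fin p)) :
    0 ≤ ∑ i, ⟪d i - ∑ j, W i j • d j, d i⟫ ∧
    ∑ i, ‖d i - ∑ j, W i j • d j‖ ^ 2 ≤ (1 - l) * ∑ i, ⟪d i - ∑ j, W i j • d j, d i⟫ := by
  have e1 : ∑ i, ⟪d i - ∑ j, W i j • d j, d i⟫ =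
      ∑ c, ∑ i, (d i c - ∑ j, W i j * d j c) * d i c := by
    rw [Finset.sum_comm]
    refine Finset.sum_congr rfl fun i _ => ?_
    simp [PiLp.inner_apply, mul_comm]
  have e2 : ∑ i, ‖d i - ∑ j, W i j • d j‖ ^ 2 =
      ∑ c, ∑ i, (d i c - ∑ j, W i j * d j c) ^ 2 := by
    rw [Finset.sum_comm]
    refine Finset.sum_congr rfl fun i _ => ?_
    simp [EuclideanSpace.real_norm_sq_eq]
  rw [e1, e2]
  have h := fun c => aux_spec W hW l h1 hl (fun i => d i c)
  refine ⟨Finset.sum_nonneg fun c _ => (h c).1, ?_⟩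
  rw [Finset.mul_sum]
  exact Finset.sum_le_sum fun c _ => (h c).2

theorem aux_comb {ι E : Type*} [Fintype ι] [NormedAddCommGroup E] [InnerProductSpace ℝ E]
    (u v : ι → E) (a b s t : ℝ) (ha : 0 ≤ a) (hb : 0 ≤ b) (hs : 0 ≤ s) (ht : 0 ≤ t)
    (hu : ∑ i, ‖u i‖ ^ 2 ≤ a * s) (hv : ∑ i, ‖v i‖ ^ 2 ≤ b * t) (hab : a + b ≤ 2) :
    ∑ i, ‖u i + v i‖ ^ 2 ≤ 2 * (s + t) := by
  have hcs : (∑ i, ‖u i‖ * ‖v i‖) ^ 2 ≤ (∑ i, ‖u i‖ ^ 2) * ∑ i, ‖v i‖ ^ 2 :=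
    Finset.sum_mul_sq_le_sq_mul_sq _ _ _
  have h2 : (∑ i, ‖u i‖ * ‖v i‖) ^ 2 ≤ (a * s) * (b * t) :=
    hcs.trans (mul_le_mul hu hv (Finset.sum_nonneg fun i _ => sq_nonneg _) (mul_nonneg ha hs))
  have h3 : 2 * ∑ i, ‖u i‖ * ‖v i‖ ≤ a * t + b * s := by
    have hp : 0 ≤ a * t + b * s := by positivity
    refine le_of_abs_le (abs_le_of_sq_le_sq ?_ hp)
    nlinarith [sq_nonneg (a * t - b * s)]
  have h4 : ∑ i, ‖u i + v i‖ ^ 2 ≤ ∑ i, (‖u i‖ ^ 2 + 2 * (‖u i‖ * ‖v i‖) + ‖v i‖ ^ 2) := by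
    refine Finset.sum_le_sum fun i _ => ?_
    rw [norm_add_sq_real]
    linarith [real_inner_le_norm (u i) (v i)]
  rw [Finset.sum_add_distrib, Finset.sum_add_distrib, ← Finset.mul_sum] at h4
  have h5 : (a + b) * (s + t) ≤ 2 * (s + t) := mul_le_mul_of_nonneg_right hab (by positivity)
  linarith

theorem aux_fix {n p : ℕ}
    (f : Fin n → EuclideanSpace ℝ (Fin p) → ℝ)
    (gf : Fin n → EuclideanSpace ℝ (Fin p) → EuclideanSpace ℝ (Fin p))
    (hgrad : ∀ i z, HasGradientAt (f i) (gf i z) z)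
    (W : Matrix (Fin n) (Fin n) ℝ)
    (hWsymm : W.IsHermitian)
    (α : ℝ)
    (ξ : (Fin n → EuclideanSpace ℝ (Fin p)) → ℝ)
    (hξ : ∀ y, ξ y = -(1/2) * (∑ i, ∑ j, W i j * ⟪y i, y j⟫)
        + ∑ i, ((1/2) * ‖y i‖ ^ 2 + α * f i (y i)))
    (xt : Fin n → EuclideanSpace ℝ (Fin p)) (hxt : ∀ z, ξ xt ≤ ξ z) (i : Fin n) :
    (xt i - ∑ j, W i j • xt j) + α • gf i (xt i) = 0 := by
  set G : Fin n → EuclideanSpace ℝ (Fin p) :=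
    fun i => (xt i - ∑ j, W i j • xt j) + α • gf i (xt i) with hG
  have hs : ∀ j k, W j k = W k j := fun j k => by
    have := hWsymm.apply k j; simpa using this
  have hcur : ∀ i, HasDerivAt (fun t : ℝ => xt i + t • G i) (G i) 0 := fun i => by
    simpa using ((hasDerivAt_id (0:ℝ)).smul_const (G i)).const_add (xt i)
  have hin : ∀ i j, HasDerivAt (fun t : ℝ => ⟪xt i + t • G i, xt j + t • G j⟫)
      (⟪xt i, G j⟫ + ⟪G i, xt j⟫) 0 := fun i j => by
    simpa using (hcur i).inner ℝ (hcur j)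
  have hD : HasDerivAt (fun t : ℝ => ξ (fun i => xt i + t • G i))
      (-(1/2) * (∑ i, ∑ j, W i j * (⟪xt i, G j⟫ + ⟪G i, xt j⟫))
        + ∑ i, ((1/2) * (⟪xt i, G i⟫ + ⟪G i, xt i⟫) + α * ⟪gf i (xt i), G i⟫)) 0 := by
    simp_rw [hξ, ← real_inner_self_eq_norm_sq]
    refine HasDerivAt.add (HasDerivAt.const_mul _ ?_) ?_
    · exact HasDerivAt.fun_sum fun i _ => HasDerivAt.fun_sum fun j _ => (hin i j).const_mul _
    · refine HasDerivAt.fun_sum fun i _ => ((hin i i).const_mul _).add (HasDerivAt.const_mul _ ?_)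
      simpa using aux_line (f i) (gf i) (hgrad i) (xt i) (G i) 0
  have hmin : IsLocalMin (fun t : ℝ => ξ (fun i => xt i + t • G i)) 0 := by
    refine Filter.Eventually.of_forall fun t => ?_
    simpa using hxt (fun i => xt i + t • G i)
  have h0 := hmin.hasDerivAt_eq_zero hD
  have e1 : ∑ i, ∑ j, W i j * (⟪xt i, G j⟫ + ⟪G i, xt j⟫) = 2 * ∑ i, ⟪∑ j, W i j • xt j, G i⟫ := by
    simp_rw [mul_add, Finset.sum_add_distrib]
    rw [Finset.sum_comm, two_mul]
    congr 1 <;> refine Finset.sum_congr rfl fun i _ => ?_ <;> rw [sum_inner] <;>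
      refine Finset.sum_congr rfl fun j _ => ?_ <;> rw [real_inner_smul_left]
    · rw [hs]
    · rw [real_inner_comm]
  have e2 : ∑ i, ‖G i‖ ^ 2 = 0 := by
    rw [← h0, e1]
    have : -(1/2:ℝ) * (2 * ∑ i, ⟪∑ j, W i j • xt j, G i⟫) = ∑ i, - ⟪∑ j, W i j • xt j, G i⟫ := by
      rw [Finset.sum_neg_distrib]; ring
    rw [this, ← Finset.sum_add_distrib]
    refine Finset.sum_congr rfl fun i _ => ?_
    rw [← real_inner_self_eq_norm_sq, real_inner_comm (xt i) (G i)]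
    have : ⟪G i, G i⟫ = ⟪(xt i - ∑ j, W i j • xt j) + α • gf i (xt i), G i⟫ := rfl
    rw [this, inner_add_left, inner_sub_left, real_inner_smul_left, real_inner_comm (G i) (xt i)]
    ring
  have := (Finset.sum_eq_zero_iff_of_nonneg fun i _ => sq_nonneg _).1 e2 i (Finset.mem_univ i)
  simpa using this

theorem bounded_distance_to_solution_set
    {n p : ℕ} (hn : 0 < n)
    (f : Fin n → EuclideanSpace ℝ (Fin p) → ℝ)
    (gf : Fin n → EuclideanSpace ℝ (Fin p) → EuclideanSpace ℝ (Fin p))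
    (Lf : Fin n → ℝ) (hLfpos : ∀ i, 0 < Lf i)
    (hconv : ∀ i, ConvexOn ℝ Set.univ (f i))
    (hbdd : ∀ i, BddBelow (Set.range (f i)))
    (hgrad : ∀ i z, HasGradientAt (f i) (gf i z) z)
    (hlip : ∀ i, LipschitzWith (Lf i).toNNReal (gf i))
    (Lh : ℝ) (hLh : Lh = ⨆ i, Lf i)
    (W : Matrix (Fin n) (Fin n) ℝ)
    (hWsymm : W.IsHermitian)
    (hWnonneg : ∀ i j, 0 ≤ W i j)
    (hWrow : ∀ i, ∑ j, W i j = 1)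
    (hWcol : ∀ j, ∑ i, W i j = 1)
    (lam : Fin n → ℝ) (hlamAnti : Antitone lam)
    (hlamEig : ∃ σ : Equiv.Perm (Fin n), lam = hWsymm.eigenvalues ∘ σ)
    (hlam1 : lam ⟨0, hn⟩ = 1)
    (lamN : ℝ) (hlamN : lamN = lam ⟨n - 1, Nat.sub_lt hn Nat.one_pos⟩)
    (hlamNlb : -1 ≤ lamN)
    (β : ℝ) (hβdef : β = ⨆ j : {j : Fin n // j ≠ (⟨0, hn⟩ : Fin n)}, |lam j.1|)
    (α : ℝ) (hα : 0 < α)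
    (x : ℕ → Fin n → EuclideanSpace ℝ (Fin p))
    (hiter : ∀ k i, x (k + 1) i = (∑ j, W i j • x k j) - α • gf i (x k i))
    (hx0 : ∀ i, x 0 i = 0)
    (ξ : (Fin n → EuclideanSpace ℝ (Fin p)) → ℝ)
    (hξ : ∀ y, ξ y = -(1/2) * (∑ i, ∑ j, W i j * ⟪y i, y j⟫)
        + ∑ i, ((1/2) * ‖y i‖ ^ 2 + α * f i (y i)))
    (hstep : α ≤ (1 + lamN) / Lh)
    (hβlt : β < 1)
    (xt : Fin n → EuclideanSpace ℝ (Fin p)) (hxt : ∀ z, ξ xt ≤ ξ z)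
    (Xstar : Set (EuclideanSpace ℝ (Fin p)))
    (hXstar : Xstar = {z | ∀ w, ∑ i, f i z ≤ ∑ i, f i w})
    (hXne : Xstar.Nonempty)
    (xstar : EuclideanSpace ℝ (Fin p)) (hxstarmem : xstar ∈ Xstar)
    (proj : EuclideanSpace ℝ (Fin p) → EuclideanSpace ℝ (Fin p))
    (hproj : ∀ z, proj z ∈ Xstar ∧ ∀ w ∈ Xstar, ‖z - proj z‖ ≤ ‖z - w‖)
    (xbar : ℕ → EuclideanSpace ℝ (Fin p)) (hxbar : ∀ k, xbar k = (n : ℝ)⁻¹ • ∑ i, x k i)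
    (C : ℝ)
    (hC : C = (Real.sqrt n)⁻¹ *
      (Real.sqrt (∑ i, ‖xt i‖ ^ 2) + Real.sqrt (∑ i, ‖xt i - xstar‖ ^ 2))) :
    ∀ k, ‖xbar k - proj (xbar k)‖ ≤ C := by
  classical
  obtain ⟨σ, hσ⟩ := hlamEig
  have heig : ∀ i, hWsymm.eigenvalues i = lam (σ.symm i) := fun i => by simp [hσ]
  have h1 : ∀ i, hWsymm.eigenvalues i ≤ 1 := fun i => by
    rw [heig, ← hlam1]; exact hlamAnti (Fin.mk_le_of_le_val (Nat.zero_le _))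
  have hl : ∀ i, lamN ≤ hWsymm.eigenvalues i := fun i => by
    rw [heig, hlamN]
    exact hlamAnti (Fin.le_def.2 (by have := (σ.symm i).2; simp; omega))
  have hLle : ∀ i, Lf i ≤ Lh := fun i => by
    rw [hLh]; exact le_ciSup (Set.finite_range Lf).bddAbove i
  have hLpos : 0 < Lh := (hLfpos ⟨0, hn⟩).trans_le (hLle _)
  have hst : α * Lh ≤ 1 + lamN := (le_div_iff₀ hLpos).1 hstep
  have hlip' : ∀ i a b, ‖gf i a - gf i b‖ ≤ Lh * ‖a - b‖ := fun i a b => by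
    have := (hlip i).dist_le_mul a b
    rw [dist_eq_norm, dist_eq_norm, Real.coe_toNNReal _ (hLfpos i).le] at this
    exact this.trans (mul_le_mul_of_nonneg_right (hLle i) (norm_nonneg _))
  have hfix := aux_fix f gf hgrad W hWsymm α ξ hξ xt hxt
  have hstepk : ∀ k, ∑ i, ‖x (k + 1) i - xt i‖ ^ 2 ≤ ∑ i, ‖x k i - xt i‖ ^ 2 := by
    intro k
    set d : Fin n → EuclideanSpace ℝ (Fin p) := fun i => x k i - xt i with hd
    set u : Fin n → EuclideanSpace ℝ (Fin p) := fun i => d i - ∑ j, W i j • d j with hu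
    set v : Fin n → EuclideanSpace ℝ (Fin p) :=
      fun i => α • (gf i (x k i) - gf i (xt i)) with hv
    obtain ⟨hs0, hus⟩ := aux_spec_vec W hWsymm lamN h1 hl d
    have hvi : ∀ i, ‖v i‖ ^ 2 ≤ (α * Lh) * ⟪v i, d i⟫ := fun i => by
      have := aux_coco (f i) (gf i) (hgrad i) (hconv i) Lh hLpos (hlip' i) (x k i) (xt i)
      simp only [hv, hd, norm_smul, mul_pow, real_inner_smul_left, Real.norm_eq_abs, sq_abs]
      have h := mul_le_mul_of_nonneg_left this (sq_nonneg α)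
      linarith
    have hvs : ∑ i, ‖v i‖ ^ 2 ≤ (α * Lh) * ∑ i, ⟪v i, d i⟫ := by
      rw [Finset.mul_sum]; exact Finset.sum_le_sum fun i _ => hvi i
    have ht0 : 0 ≤ ∑ i, ⟪v i, d i⟫ := Finset.sum_nonneg fun i _ =>
      nonneg_of_mul_nonneg_right ((sq_nonneg _).trans (hvi i)) (mul_pos hα hLpos)
    have hl1 : 0 ≤ 1 - lamN := by linarith [h1 ⟨0, hn⟩, hl ⟨0, hn⟩]
    have hc := aux_comb u v (1 - lamN) (α * Lh) _ _ hl1 (mul_pos hα hLpos).le hs0 ht0 hus hvs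
      (by linarith)
    have hx : ∀ i, x (k + 1) i - xt i = d i - (u i + v i) := fun i => by
      have h := hfix i
      have h' : x (k + 1) i - xt i = x (k + 1) i - xt i +
        ((xt i - ∑ j, W i j • xt j) + α • gf i (xt i)) := by rw [h, add_zero]
      rw [h', hiter]
      simp only [hu, hv, hd, smul_sub, Finset.sum_sub_distrib]
      abel
    have e : ∑ i, ‖x (k + 1) i - xt i‖ ^ 2 =
        ∑ i, ‖d i‖ ^ 2 - 2 * (∑ i, ⟪u i, d i⟫ + ∑ i, ⟪v i, d i⟫) + ∑ i, ‖u i + v i‖ ^ 2 := by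
      rw [← Finset.sum_add_distrib, Finset.mul_sum, ← Finset.sum_sub_distrib,
        ← Finset.sum_add_distrib]
      refine Finset.sum_congr rfl fun i _ => ?_
      rw [hx, norm_sub_sq_real, real_inner_comm, inner_add_left]
    rw [e]
    linarith
  have hk : ∀ k, ∑ i, ‖x k i - xt i‖ ^ 2 ≤ ∑ i, ‖xt i‖ ^ 2 := by
    intro k
    induction k with
    | zero => simp [hx0]
    | succ k ih => exact (hstepk k).trans ih
  intro k
  refine ((hproj (xbar k)).2 xstar hxstarmem).trans ?_
  have hn' : (0:ℝ) < n := by exact_mod_cast hn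
  have hL2 : ∀ y : Fin n → EuclideanSpace ℝ (Fin p),
      ‖(WithLp.toLp 2 y : PiLp 2 fun _ : Fin n => EuclideanSpace ℝ (Fin p))‖
        = Real.sqrt (∑ i, ‖y i‖ ^ 2) := fun y => by
    rw [PiLp.norm_eq_of_L2]
  have htri : Real.sqrt (∑ i, ‖x k i - xstar‖ ^ 2) ≤
      Real.sqrt (∑ i, ‖x k i - xt i‖ ^ 2) + Real.sqrt (∑ i, ‖xt i - xstar‖ ^ 2) := by
    have := norm_add_le
      (WithLp.toLp 2 (fun i => x k i - xt i) : PiLp 2 fun _ : Fin n => EuclideanSpace ℝ (Fin p))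
      (WithLp.toLp 2 (fun i => xt i - xstar))
    rw [← WithLp.toLp_add, hL2, hL2, hL2] at this
    simpa using this
  have hmean : ‖xbar k - xstar‖ ≤ (Real.sqrt n)⁻¹ * Real.sqrt (∑ i, ‖x k i - xstar‖ ^ 2) := by
    have e : xbar k - xstar = (n : ℝ)⁻¹ • ∑ i, (x k i - xstar) := by
      rw [hxbar, Finset.sum_sub_distrib, smul_sub]
      simp only [Finset.sum_const, Finset.card_univ, Fintype.card_fin]
      rw [← Nat.cast_smul_eq_nsmul ℝ, smul_smul, inv_mul_cancel₀ hn'.ne', one_smul]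
    have h2 : (∑ i, ‖x k i - xstar‖) ^ 2 ≤ n * ∑ i, ‖x k i - xstar‖ ^ 2 := by
      simpa using sq_sum_le_card_mul_sum_sq (s := Finset.univ) (f := fun i => ‖x k i - xstar‖)
    have h3 : ∑ i, ‖x k i - xstar‖ ≤ Real.sqrt n * Real.sqrt (∑ i, ‖x k i - xstar‖ ^ 2) := by
      rw [← Real.sqrt_mul hn'.le]
      exact Real.le_sqrt_of_sq_le h2
    rw [e, norm_smul, Real.norm_of_nonneg (inv_nonneg.2 hn'.le)]
    calc (n:ℝ)⁻¹ * ‖∑ i, (x k i - xstar)‖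
        ≤ (n:ℝ)⁻¹ * (Real.sqrt n * Real.sqrt (∑ i, ‖x k i - xstar‖ ^ 2)) := by
          gcongr; exact (norm_sum_le _ _).trans h3
      _ = (Real.sqrt n)⁻¹ * Real.sqrt (∑ i, ‖x k i - xstar‖ ^ 2) := by
          have hsq : Real.sqrt n * Real.sqrt n = n := Real.mul_self_sqrt hn'.le
          have hs0 : Real.sqrt n ≠ 0 := (Real.sqrt_pos.2 hn').ne'
          rw [← mul_assoc]
          congr 1
          nth_rewrite 1 [← hsq]
          field_simp
  refine hmean.trans ?_
  rw [hC]
  gcongr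
  exact htri.trans (add_le_add_left (Real.sqrt_le_sqrt (hk k)) _)
end

section
/- Under the stepsize condition α ≤ min{(1 + λ_n(W))/L_h, 1/L_f̄} and β < 1, the mean objective error satisfies for all k ≥ 0: r̄(k+1) ≤ r̄(k) − (α/2) ‖ḡ(k)‖² + α³ D² L_h² / (2(1 − β)²), where D := √(2 L_h (Σ_{i=1}^n f_i(0) − Σ_{i=1}^n inf_x f_i(x))). -/
open scoped RealInnerProductSpace

lemma aux_eig {n : ℕ} {W : Matrix (Fin n) (Fin n) ℝ} (hW : W.IsHermitian)
    (u : EuclideanSpace ℝ (Fin n)) (i : Fin n) :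
    inner ℝ (hW.eigenvectorBasis i) (WithLp.toLp 2 (W.mulVec u.ofLp)) =
      hW.eigenvalues i * inner ℝ (hW.eigenvectorBasis i) u := by
  have hT : W.transpose = W := by
    have := hW.eq
    rwa [Matrix.conjTranspose_eq_transpose_of_trivial] at this
  rw [EuclideanSpace.inner_eq_star_dotProduct, EuclideanSpace.inner_eq_star_dotProduct]
  simp only [star_trivial]
  rw [dotProduct_comm, Matrix.dotProduct_mulVec, ← Matrix.mulVec_transpose, hT,
    hW.mulVec_eigenvectorBasis, smul_dotProduct, dotProduct_comm, smul_eq_mul]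

lemma aux_quad {n : ℕ} {W : Matrix (Fin n) (Fin n) ℝ} (hW : W.IsHermitian)
    (u : EuclideanSpace ℝ (Fin n)) :
    inner ℝ u (WithLp.toLp 2 (W.mulVec u.ofLp)) =
      ∑ i, hW.eigenvalues i * inner ℝ (hW.eigenvectorBasis i) u ^ 2 := by
  rw [← OrthonormalBasis.sum_inner_mul_inner hW.eigenvectorBasis]
  refine Finset.sum_congr rfl fun i _ => ?_
  rw [aux_eig, real_inner_comm]; ring

lemma aux_lower {n : ℕ} {W : Matrix (Fin n) (Fin n) ℝ} (hW : W.IsHermitian) (a : ℝ)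
    (ha : ∀ i, a ≤ hW.eigenvalues i) (u : Fin n → ℝ) :
    a * ∑ i, u i ^ 2 ≤ ∑ i, ∑ j, W i j * (u i * u j) := by
  have h := aux_quad hW (WithLp.toLp 2 u)
  have h2 := OrthonormalBasis.sum_sq_inner_right hW.eigenvectorBasis (WithLp.toLp 2 u)
  rw [EuclideanSpace.real_norm_sq_eq] at h2
  have h3 : inner ℝ (WithLp.toLp 2 u) (WithLp.toLp 2 (W.mulVec u)) =
      ∑ i, ∑ j, W i j * (u i * u j) := by
    rw [PiLp.inner_apply]
    refine Finset.sum_congr rfl fun i _ => ?_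
    simp only [Matrix.mulVec, dotProduct, RCLike.inner_apply, conj_trivial, Finset.sum_mul]
    exact Finset.sum_congr rfl fun j _ => by ring
  simp only at h h2
  rw [← h3, h, ← h2, Finset.mul_sum]
  exact Finset.sum_le_sum fun i _ => mul_le_mul_of_nonneg_right (ha i) (sq_nonneg _)

lemma aux_upper {n : ℕ} {W : Matrix (Fin n) (Fin n) ℝ} (hW : W.IsHermitian) (a : ℝ)
    (ha : ∀ i, hW.eigenvalues i ≤ a) (u : Fin n → ℝ) :
    ∑ i, ∑ j, W i j * (u i * u j) ≤ a * ∑ i, u i ^ 2 := by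
  have h := aux_quad hW (WithLp.toLp 2 u)
  have h2 := OrthonormalBasis.sum_sq_inner_right hW.eigenvectorBasis (WithLp.toLp 2 u)
  rw [EuclideanSpace.real_norm_sq_eq] at h2
  have h3 : inner ℝ (WithLp.toLp 2 u) (WithLp.toLp 2 (W.mulVec u)) =
      ∑ i, ∑ j, W i j * (u i * u j) := by
    rw [PiLp.inner_apply]
    refine Finset.sum_congr rfl fun i _ => ?_
    simp only [Matrix.mulVec, dotProduct, RCLike.inner_apply, conj_trivial, Finset.sum_mul]
    exact Finset.sum_congr rfl fun j _ => by ring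
  simp only at h h2
  rw [← h3, h, ← h2, Finset.mul_sum]
  exact Finset.sum_le_sum fun i _ => mul_le_mul_of_nonneg_right (ha i) (sq_nonneg _)

lemma aux_contr {n : ℕ} {W : Matrix (Fin n) (Fin n) ℝ} (hW : W.IsHermitian)
    (hrow : ∀ i, ∑ j, W i j = 1) (i0 : Fin n) (β : ℝ) (hβ : β < 1)
    (hb : ∀ i, i ≠ i0 → |hW.eigenvalues i| ≤ β) (u : Fin n → ℝ) (hu : ∑ i, u i = 0) :
    ∑ i, (∑ j, W i j * u j) ^ 2 ≤ β ^ 2 * ∑ i, u i ^ 2 := by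
  set b := hW.eigenvectorBasis with hbdef
  set e : EuclideanSpace ℝ (Fin n) := WithLp.toLp 2 (fun _ => 1) with he
  have hWe : WithLp.toLp 2 (W.mulVec e.ofLp) = e := by
    ext i; simp [he, Matrix.mulVec, dotProduct, hrow]
  have h0 : ∀ i, i ≠ i0 → inner ℝ (b i) e = 0 := by
    intro i hi
    have h := aux_eig hW e i
    rw [hWe] at h
    have h1 := (abs_le.1 (hb i hi)).2
    have h4 : (1 - hW.eigenvalues i) * inner ℝ (b i) e = 0 := by linarith
    rcases mul_eq_zero.1 h4 with h5 | h5
    · linarith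
    · exact h5
  have heu : inner ℝ e (WithLp.toLp 2 u) = 0 := by
    rw [PiLp.inner_apply]; simpa [he] using hu
  have hee := OrthonormalBasis.sum_sq_inner_right b e
  rw [Finset.sum_eq_single i0 (fun i _ hi => by rw [h0 i hi]; norm_num) (by simp)] at hee
  rw [EuclideanSpace.real_norm_sq_eq] at hee
  have hpos : (0 : ℝ) < n := by exact_mod_cast i0.pos
  have hee' : inner ℝ (b i0) e ^ 2 = (n : ℝ) := by rw [hee]; simp [he]
  have hne : inner ℝ (b i0) e ≠ 0 := by
    intro h; rw [h] at hee'; norm_num at hee'; linarith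
  have hu0 : inner ℝ (b i0) (WithLp.toLp 2 u) = 0 := by
    rw [← OrthonormalBasis.sum_inner_mul_inner b, Finset.sum_eq_single i0 (fun i _ hi => by
      rw [real_inner_comm, h0 i hi, zero_mul]) (by simp), real_inner_comm] at heu
    exact (mul_eq_zero.1 heu).resolve_left hne
  have h2 := OrthonormalBasis.sum_sq_inner_right b (WithLp.toLp 2 u)
  have h3 := OrthonormalBasis.sum_sq_inner_right b (WithLp.toLp 2 (W.mulVec u))
  rw [EuclideanSpace.real_norm_sq_eq] at h2 h3
  have h4 : ∑ i, (∑ j, W i j * u j) ^ 2 = ∑ i, (W.mulVec u i) ^ 2 := rfl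
  simp only at h2 h3
  rw [h4, ← h3, ← h2, Finset.mul_sum]
  refine Finset.sum_le_sum fun i _ => ?_
  have h5 := aux_eig hW (WithLp.toLp 2 u) i
  simp only at h5
  rw [← hbdef] at h5
  rw [h5]
  by_cases hi : i = i0
  · subst hi; rw [hu0]; simp
  · rw [mul_pow]
    have h6 : hW.eigenvalues i ^ 2 ≤ β ^ 2 := by
      rw [← sq_abs]; exact pow_le_pow_left₀ (abs_nonneg _) (hb i hi) 2
    exact mul_le_mul_of_nonneg_right h6 (sq_nonneg _)

lemma vec_swap {n p : ℕ} (W : Matrix (Fin n) (Fin n) ℝ) (v : Fin n → EuclideanSpace ℝ (Fin p)) :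
    ∑ i, ∑ j, W i j * inner ℝ (v i) (v j) =
      ∑ c, ∑ i, ∑ j, W i j * ((v i) c * (v j) c) := by
  symm
  rw [Finset.sum_comm]
  refine Finset.sum_congr rfl fun i _ => ?_
  rw [Finset.sum_comm]
  refine Finset.sum_congr rfl fun j _ => ?_
  rw [PiLp.inner_apply, Finset.mul_sum]
  refine Finset.sum_congr rfl fun c _ => ?_
  simp [mul_comm]

lemma vec_norm {n p : ℕ} (v : Fin n → EuclideanSpace ℝ (Fin p)) :
    ∑ i, ‖v i‖ ^ 2 = ∑ c, ∑ i, (v i) c ^ 2 := by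
  rw [Finset.sum_comm]
  exact Finset.sum_congr rfl fun i _ => EuclideanSpace.real_norm_sq_eq _

lemma vec_lower {n p : ℕ} {W : Matrix (Fin n) (Fin n) ℝ} (hW : W.IsHermitian) (a : ℝ)
    (ha : ∀ i, a ≤ hW.eigenvalues i) (v : Fin n → EuclideanSpace ℝ (Fin p)) :
    a * ∑ i, ‖v i‖ ^ 2 ≤ ∑ i, ∑ j, W i j * inner ℝ (v i) (v j) := by
  rw [vec_swap, vec_norm, Finset.mul_sum]
  exact Finset.sum_le_sum fun c _ => aux_lower hW a ha _

lemma vec_upper {n p : ℕ} {W : Matrix (Fin n) (Fin n) ℝ} (hW : W.IsHermitian) (a : ℝ)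
    (ha : ∀ i, hW.eigenvalues i ≤ a) (v : Fin n → EuclideanSpace ℝ (Fin p)) :
    ∑ i, ∑ j, W i j * inner ℝ (v i) (v j) ≤ a * ∑ i, ‖v i‖ ^ 2 := by
  rw [vec_swap, vec_norm, Finset.mul_sum]
  exact Finset.sum_le_sum fun c _ => aux_upper hW a ha _

lemma vec_contr {n p : ℕ} {W : Matrix (Fin n) (Fin n) ℝ} (hW : W.IsHermitian)
    (hrow : ∀ i, ∑ j, W i j = 1) (i0 : Fin n) (β : ℝ) (hβ : β < 1)
    (hb : ∀ i, i ≠ i0 → |hW.eigenvalues i| ≤ β) (v : Fin n → EuclideanSpace ℝ (Fin p))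
    (hv : ∑ i, v i = 0) :
    ∑ i, ‖∑ j, W i j • v j‖ ^ 2 ≤ β ^ 2 * ∑ i, ‖v i‖ ^ 2 := by
  rw [vec_norm, vec_norm, Finset.mul_sum]
  refine Finset.sum_le_sum fun c _ => ?_
  have h := aux_contr hW hrow i0 β hβ hb (fun i => v i c) (by
    have := congrArg (fun z : EuclideanSpace ℝ (Fin p) => z c) hv
    simpa using this)
  simpa using h

lemma descent {E : Type*} [NormedAddCommGroup E] [InnerProductSpace ℝ E] [CompleteSpace E]
    (f : E → ℝ) (g : E → E) (L : ℝ) (hg : ∀ z, HasGradientAt f (g z) z)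
    (hl : ∀ y z, ‖g y - g z‖ ≤ L * ‖y - z‖) (x d : E) :
    f (x + d) ≤ f x + inner ℝ (g x) d + L / 2 * ‖d‖ ^ 2 := by
  have hd : ∀ t : ℝ, HasDerivAt (fun t : ℝ => f (x + t • d)) (inner ℝ (g (x + t • d)) d) t := by
    intro t
    have h1 : HasDerivAt (fun t : ℝ => x + t • d) d t := by
      simpa using ((hasDerivAt_id t).smul_const d).const_add x
    have h2 := (hg (x + t • d)).hasFDerivAt.comp_hasDerivAt t h1
    simp only [InnerProductSpace.toDual_apply_apply] at h2
    exact h2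
  have hB : ∀ t : ℝ, HasDerivAt (fun t : ℝ => f x + t * inner ℝ (g x) d + L / 2 * t ^ 2 * ‖d‖ ^ 2)
      (inner ℝ (g x) d + L * t * ‖d‖ ^ 2) t := by
    intro t
    have h1 : HasDerivAt (fun t : ℝ => f x + t * inner ℝ (g x) d) (inner ℝ (g x) d) t := by
      simpa using ((hasDerivAt_id t).mul_const (inner ℝ (g x) d)).const_add (f x)
    have h2 := ((hasDerivAt_pow 2 t).const_mul (L / 2)).mul_const (‖d‖ ^ 2)
    exact (h1.add h2).congr_deriv (by push_cast; ring)
  have := image_le_of_deriv_right_le_deriv_boundary (a := 0) (b := 1)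
    (f := fun t : ℝ => f (x + t • d)) (f' := fun t => inner ℝ (g (x + t • d)) d)
    (fun t _ => (hd t).continuousAt.continuousWithinAt)
    (fun t _ => (hd t).hasDerivWithinAt)
    (B := fun t : ℝ => f x + t * inner ℝ (g x) d + L / 2 * t ^ 2 * ‖d‖ ^ 2)
    (B' := fun t => inner ℝ (g x) d + L * t * ‖d‖ ^ 2) (by simp)
    (fun t _ => (hB t).continuousAt.continuousWithinAt)
    (fun t _ => (hB t).hasDerivWithinAt)
    (by
      intro t ht
      have h1 : inner ℝ (g (x + t • d) - g x) d ≤ ‖g (x + t • d) - g x‖ * ‖d‖ :=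
        real_inner_le_norm _ _
      have h2 := hl (x + t • d) x
      rw [add_sub_cancel_left, norm_smul, Real.norm_of_nonneg ht.1] at h2
      have h3 := mul_le_mul_of_nonneg_right h2 (norm_nonneg d)
      rw [inner_sub_left] at h1
      nlinarith)
    (show (1 : ℝ) ∈ Set.Icc 0 1 by simp)
  simpa using this

lemma grad_bound {E : Type*} [NormedAddCommGroup E] [InnerProductSpace ℝ E] [CompleteSpace E]
    (f : E → ℝ) (g : E → E) (L : ℝ) (hL : 0 < L) (hg : ∀ z, HasGradientAt f (g z) z)
    (hl : ∀ y z, ‖g y - g z‖ ≤ L * ‖y - z‖) (hb : BddBelow (Set.range f)) (x : E) :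
    ‖g x‖ ^ 2 ≤ 2 * L * (f x - ⨅ z, f z) := by
  have h := descent f g L hg hl x (-(L⁻¹ • g x))
  have h1 := ciInf_le hb (x + -(L⁻¹ • g x))
  rw [inner_neg_right, inner_smul_right, real_inner_self_eq_norm_sq, norm_neg, norm_smul,
    mul_pow, Real.norm_of_nonneg (inv_nonneg.2 hL.le)] at h
  have h2 : L⁻¹ * ‖g x‖ ^ 2 - L / 2 * (L⁻¹ ^ 2 * ‖g x‖ ^ 2) = ‖g x‖ ^ 2 / (2 * L) := by
    field_simp; ring
  have h3 : ‖g x‖ ^ 2 / (2 * L) ≤ f x - ⨅ z, f z := by linarith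
  rw [div_le_iff₀ (by positivity)] at h3
  linarith

lemma minkowski {n : ℕ} {E : Type*} [NormedAddCommGroup E] [InnerProductSpace ℝ E]
    (a b : Fin n → E) (A B : ℝ) (hA : 0 ≤ A) (hB : 0 ≤ B) (ha : ∑ i, ‖a i‖ ^ 2 ≤ A ^ 2)
    (hb : ∑ i, ‖b i‖ ^ 2 ≤ B ^ 2) : ∑ i, ‖a i - b i‖ ^ 2 ≤ (A + B) ^ 2 := by
  let a' : PiLp 2 (fun _ : Fin n => E) := WithLp.toLp 2 a
  let b' : PiLp 2 (fun _ : Fin n => E) := WithLp.toLp 2 b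
  have h1 : ‖a'‖ ^ 2 ≤ A ^ 2 := by rw [PiLp.norm_sq_eq_of_L2]; exact ha
  have h2 : ‖b'‖ ^ 2 ≤ B ^ 2 := by rw [PiLp.norm_sq_eq_of_L2]; exact hb
  have h3 : ‖a' - b'‖ ^ 2 = ∑ i, ‖a i - b i‖ ^ 2 := by rw [PiLp.norm_sq_eq_of_L2]; rfl
  rw [← h3]
  have h4 := abs_le.1 (abs_le_of_sq_le_sq h1 hA)
  have h5 := abs_le.1 (abs_le_of_sq_le_sq h2 hB)
  exact pow_le_pow_left₀ (norm_nonneg _)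
    ((norm_sub_le _ _).trans (add_le_add h4.2 h5.2)) 2


theorem mean_objective_error_descent
    {n p : ℕ} (hn : 0 < n)
    (f : Fin n → EuclideanSpace ℝ (Fin p) → ℝ)
    (gf : Fin n → EuclideanSpace ℝ (Fin p) → EuclideanSpace ℝ (Fin p))
    (Lf : Fin n → ℝ) (hLfpos : ∀ i, 0 < Lf i)
    (hconv : ∀ i, ConvexOn ℝ Set.univ (f i))
    (hbdd : ∀ i, BddBelow (Set.range (f i)))
    (hgrad : ∀ i z, HasGradientAt (f i) (gf i z) z)
    (hlip : ∀ i, LipschitzWith (Lf i).toNNReal (gf i))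
    (Lh : ℝ) (hLh : Lh = ⨆ i, Lf i)
    (W : Matrix (Fin n) (Fin n) ℝ)
    (hWsymm : W.IsHermitian)
    (hWnonneg : ∀ i j, 0 ≤ W i j)
    (hWrow : ∀ i, ∑ j, W i j = 1)
    (hWcol : ∀ j, ∑ i, W i j = 1)
    (lam : Fin n → ℝ) (hlamAnti : Antitone lam)
    (hlamEig : ∃ σ : Equiv.Perm (Fin n), lam = hWsymm.eigenvalues ∘ σ)
    (hlam1 : lam ⟨0, hn⟩ = 1)
    (lamN : ℝ) (hlamN : lamN = lam ⟨n - 1, Nat.sub_lt hn Nat.one_pos⟩)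
    (hlamNlb : -1 ≤ lamN)
    (β : ℝ) (hβdef : β = ⨆ j : {j : Fin n // j ≠ (⟨0, hn⟩ : Fin n)}, |lam j.1|)
    (α : ℝ) (hα : 0 < α)
    (x : ℕ → Fin n → EuclideanSpace ℝ (Fin p))
    (hiter : ∀ k i, x (k + 1) i = (∑ j, W i j • x k j) - α • gf i (x k i))
    (hx0 : ∀ i, x 0 i = 0)
    (D : ℝ) (hD : D = Real.sqrt (2 * Lh * ((∑ i, f i 0) - ∑ i, ⨅ z, f i z)))
    (xbar : ℕ → EuclideanSpace ℝ (Fin p)) (hxbar : ∀ k, xbar k = (n : ℝ)⁻¹ • ∑ i, x k i)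
    (gbar : ℕ → EuclideanSpace ℝ (Fin p)) (hgbar : ∀ k, gbar k = (n : ℝ)⁻¹ • ∑ i, gf i (xbar k))
    (fbar : EuclideanSpace ℝ (Fin p) → ℝ) (hfbar : ∀ z, fbar z = (n : ℝ)⁻¹ * ∑ i, f i z)
    (Lfbar : ℝ) (hLfbar : Lfbar = (n : ℝ)⁻¹ * ∑ i, Lf i)
    (xstar : EuclideanSpace ℝ (Fin p)) (hxstar : ∀ z, ∑ i, f i xstar ≤ ∑ i, f i z)
    (rbar : ℕ → ℝ) (hrbar : ∀ k, rbar k = fbar (xbar k) - fbar xstar)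
    (hstep : α ≤ min ((1 + lamN) / Lh) (1 / Lfbar))
    (hβlt : β < 1)
 :
    ∀ k, rbar (k + 1)
      ≤ rbar k - (α / 2) * ‖gbar k‖ ^ 2 + α ^ 3 * D ^ 2 * Lh ^ 2 / (2 * (1 - β) ^ 2) := by
  have hnpos : (0 : ℝ) < n := by exact_mod_cast hn
  have hnne : (n : ℝ) ≠ 0 := hnpos.ne'
  have hLle : ∀ i, Lf i ≤ Lh := fun i => by
    rw [hLh]; exact le_ciSup (Set.finite_range Lf).bddAbove i
  have hLhpos : 0 < Lh := (hLfpos ⟨0, hn⟩).trans_le (hLle _)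
  have hlipR : ∀ i y z, ‖gf i y - gf i z‖ ≤ Lf i * ‖y - z‖ := by
    intro i y z
    have := (hlip i).dist_le_mul y z
    rwa [dist_eq_norm, dist_eq_norm, Real.coe_toNNReal _ (hLfpos i).le] at this
  have hlipH : ∀ i y z, ‖gf i y - gf i z‖ ≤ Lh * ‖y - z‖ := fun i y z =>
    (hlipR i y z).trans (mul_le_mul_of_nonneg_right (hLle i) (norm_nonneg _))
  have hLfbarpos : 0 < Lfbar := by
    rw [hLfbar]
    have : 0 < ∑ i, Lf i := Finset.sum_pos (fun i _ => hLfpos i) ⟨⟨0, hn⟩, Finset.mem_univ _⟩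
    positivity
  have hs1 : α * Lh ≤ 1 + lamN := (le_div_iff₀ hLhpos).1 (hstep.trans (min_le_left _ _))
  have hs2 : α * Lfbar ≤ 1 := (le_div_iff₀ hLfbarpos).1 (hstep.trans (min_le_right _ _))
  obtain ⟨σ, hσ⟩ := hlamEig
  have heig : ∀ i, hWsymm.eigenvalues i = lam (σ.symm i) := by intro i; rw [hσ]; simp
  have hlow : ∀ i, lamN ≤ hWsymm.eigenvalues i := by
    intro i; rw [heig, hlamN]
    exact hlamAnti (Fin.mk_le_mk.2 (Nat.le_sub_one_of_lt (σ.symm i).2))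
  have hup : ∀ i, hWsymm.eigenvalues i ≤ 1 := by
    intro i; rw [heig, ← hlam1]
    exact hlamAnti (Fin.mk_le_mk.2 (Nat.zero_le _))
  have hβ0 : 0 ≤ β := by rw [hβdef]; exact Real.iSup_nonneg fun _ => abs_nonneg _
  have hb : ∀ i, i ≠ σ ⟨0, hn⟩ → |hWsymm.eigenvalues i| ≤ β := by
    intro i hi
    have hne : σ.symm i ≠ ⟨0, hn⟩ := fun h => hi (by rw [← h]; simp)
    rw [heig, hβdef]
    exact le_ciSup (f := fun j : {j : Fin n // j ≠ (⟨0, hn⟩ : Fin n)} => |lam j.1|)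
      (Set.finite_range _).bddAbove ⟨σ.symm i, hne⟩
  have hWs : ∀ i j, W i j = W j i := fun i j => by
    have := hWsymm.apply j i; simpa using this
  -- Lyapunov function
  let Q : (Fin n → EuclideanSpace ℝ (Fin p)) → ℝ := fun v =>
    (∑ i, ‖v i‖ ^ 2) / 2 - (∑ i, ∑ j, W i j * inner ℝ (v i) (v j)) / 2
  have hQ0 : ∀ v, 0 ≤ Q v := by
    intro v
    have := vec_upper hWsymm 1 hup v
    simp only [Q]; linarith
  have hQ1 : ∀ v, Q v ≤ (1 - lamN) / 2 * ∑ i, ‖v i‖ ^ 2 := by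
    intro v
    have := vec_lower hWsymm lamN hlow v
    simp only [Q]; linarith
  have hQadd : ∀ v d : Fin n → EuclideanSpace ℝ (Fin p), Q (fun i => v i + d i) =
      Q v + ∑ i, inner ℝ (v i - ∑ j, W i j • v j) (d i) + Q d := by
    intro v d
    have h1 : ∑ i, ‖v i + d i‖ ^ 2 =
        ∑ i, ‖v i‖ ^ 2 + 2 * ∑ i, inner ℝ (v i) (d i) + ∑ i, ‖d i‖ ^ 2 := by
      rw [Finset.mul_sum, ← Finset.sum_add_distrib, ← Finset.sum_add_distrib]
      exact Finset.sum_congr rfl fun i _ => norm_add_sq_real _ _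
    have h2 : ∑ i, inner ℝ (v i - ∑ j, W i j • v j) (d i) =
        ∑ i, inner ℝ (v i) (d i) - ∑ i, ∑ j, W i j * inner ℝ (v j) (d i) := by
      rw [← Finset.sum_sub_distrib]
      refine Finset.sum_congr rfl fun i _ => ?_
      rw [inner_sub_left, sum_inner]
      simp only [real_inner_smul_left]
    have h3 : ∑ i, ∑ j, W i j * inner ℝ (v i + d i) (v j + d j) =
        ∑ i, ∑ j, W i j * inner ℝ (v i) (v j) + ∑ i, ∑ j, W i j * inner ℝ (v i) (d j)
        + ∑ i, ∑ j, W i j * inner ℝ (v j) (d i) + ∑ i, ∑ j, W i j * inner ℝ (d i) (d j) := by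
      simp only [← Finset.sum_add_distrib]
      refine Finset.sum_congr rfl fun i _ => Finset.sum_congr rfl fun j _ => ?_
      rw [inner_add_left, inner_add_right, inner_add_right, real_inner_comm (v j) (d i)]; ring
    have h4 : ∑ i, ∑ j, W i j * inner ℝ (v i) (d j) = ∑ i, ∑ j, W i j * inner ℝ (v j) (d i) := by
      rw [Finset.sum_comm]
      exact Finset.sum_congr rfl fun i _ => Finset.sum_congr rfl fun j _ => by rw [hWs]
    simp only [Q]
    rw [h1, h2, h3, h4]; ring
  have hLyap : ∀ k, Q (x k) + α * ∑ i, f i (x k i) ≤ α * ∑ i, f i 0 := by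
    intro k
    induction k with
    | zero => simp [Q, hx0]
    | succ k ih =>
      refine le_trans ?_ ih
      let d : Fin n → EuclideanSpace ℝ (Fin p) := fun i => x (k + 1) i - x k i
      have hxd : x (k + 1) = fun i => x k i + d i := by ext1 i; simp [d]
      have hf : ∑ i, f i (x (k + 1) i) ≤ ∑ i, f i (x k i) + ∑ i, inner ℝ (gf i (x k i)) (d i)
          + Lh / 2 * ∑ i, ‖d i‖ ^ 2 := by
        rw [Finset.mul_sum, ← Finset.sum_add_distrib, ← Finset.sum_add_distrib]
        refine Finset.sum_le_sum fun i _ => ?_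
        rw [hxd]
        exact descent (f i) (gf i) Lh (hgrad i) (hlipH i) (x k i) (d i)
      have hq := hQadd (x k) d
      rw [← hxd] at hq
      have h1 := hQ1 d
      have h2 : ∑ i, inner ℝ (x k i - ∑ j, W i j • x k j) (d i) +
          α * ∑ i, inner ℝ (gf i (x k i)) (d i) = - ∑ i, ‖d i‖ ^ 2 := by
        rw [Finset.mul_sum, ← Finset.sum_add_distrib, ← Finset.sum_neg_distrib]
        refine Finset.sum_congr rfl fun i _ => ?_
        rw [← real_inner_smul_left, ← inner_add_left, ← real_inner_self_eq_norm_sq,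
          ← inner_neg_left]
        congr 1
        simp only [d, hiter]; abel
      have h3 : 0 ≤ ∑ i, ‖d i‖ ^ 2 := Finset.sum_nonneg fun i _ => sq_nonneg _
      have h4 := mul_le_mul_of_nonneg_left hf hα.le
      have h5 := mul_le_mul_of_nonneg_right hs1 h3
      nlinarith
  have hfk : ∀ k, ∑ i, f i (x k i) ≤ ∑ i, f i 0 := fun k => by
    have h1 := hLyap k
    have h2 := hQ0 (x k)
    exact le_of_mul_le_mul_left (by linarith) hα
  have hgk : ∀ k, ∑ i, ‖gf i (x k i)‖ ^ 2 ≤ 2 * Lh * ((∑ i, f i 0) - ∑ i, ⨅ z, f i z) := by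
    intro k
    have h1 : ∑ i, ‖gf i (x k i)‖ ^ 2 ≤ 2 * Lh * ((∑ i, f i (x k i)) - ∑ i, ⨅ z, f i z) := by
      rw [← Finset.sum_sub_distrib, Finset.mul_sum]
      exact Finset.sum_le_sum fun i _ =>
        grad_bound (f i) (gf i) Lh hLhpos (hgrad i) (hlipH i) (hbdd i) (x k i)
    refine h1.trans ?_
    have := hfk k
    gcongr
  have hD0 : 0 ≤ D := by rw [hD]; exact Real.sqrt_nonneg _
  have hgD : ∀ k, ∑ i, ‖gf i (x k i)‖ ^ 2 ≤ D ^ 2 := by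
    intro k
    rw [hD, Real.sq_sqrt]
    · exact hgk k
    · exact (Finset.sum_nonneg fun i _ => sq_nonneg _).trans (hgk k)
  -- mean
  let G : ℕ → EuclideanSpace ℝ (Fin p) := fun k => (n : ℝ)⁻¹ • ∑ i, gf i (x k i)
  have hxb : ∀ k, xbar (k + 1) = xbar k - α • G k := by
    intro k
    rw [hxbar, hxbar]
    simp only [hiter, G, Finset.sum_sub_distrib]
    rw [Finset.sum_comm]
    simp only [← Finset.sum_smul, hWcol, one_smul, ← Finset.smul_sum]
    rw [smul_sub, smul_comm]
  have hsum0 : ∀ k, ∑ i, (x k i - xbar k) = 0 := by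
    intro k
    rw [Finset.sum_sub_distrib, hxbar]
    simp only [Finset.sum_const, Finset.card_univ, Fintype.card_fin]
    rw [← Nat.cast_smul_eq_nsmul ℝ, smul_smul, mul_inv_cancel₀ hnne, one_smul, sub_self]
  have h1β : 0 < 1 - β := by linarith
  have hvar : ∀ k, ∑ i, ‖α • (gf i (x k i) - G k)‖ ^ 2 ≤ (α * D) ^ 2 := by
    intro k
    have hG : ∑ i, gf i (x k i) = (n : ℝ) • G k := by
      simp only [G]; rw [smul_smul, mul_inv_cancel₀ hnne, one_smul]
    have h1 : ∑ i, ‖gf i (x k i) - G k‖ ^ 2 = ∑ i, ‖gf i (x k i)‖ ^ 2 - n * ‖G k‖ ^ 2 := by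
      simp only [norm_sub_sq_real, Finset.sum_add_distrib, Finset.sum_sub_distrib, ← Finset.mul_sum,
        ← sum_inner, hG, real_inner_smul_left, real_inner_self_eq_norm_sq, Finset.sum_const,
        Finset.card_univ, Fintype.card_fin, nsmul_eq_mul]
      ring
    simp only [norm_smul, mul_pow, ← Finset.mul_sum, Real.norm_of_nonneg hα.le]
    have h2 : 0 ≤ n * ‖G k‖ ^ 2 := by positivity
    have h3 := hgD k
    gcongr
    linarith
  have hdev : ∀ k, ∑ i, ‖x k i - xbar k‖ ^ 2 ≤ (α * D / (1 - β)) ^ 2 := by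
    intro k
    induction k with
    | zero =>
      have : xbar 0 = 0 := by rw [hxbar]; simp [hx0]
      simp only [hx0, this]
      simp
      positivity
    | succ k ih =>
      have h1 := vec_contr hWsymm hWrow _ β hβlt hb (fun i => x k i - xbar k) (hsum0 k)
      have h2 : ∑ i, ‖∑ j, W i j • (x k j - xbar k)‖ ^ 2 ≤ (β * (α * D / (1 - β))) ^ 2 := by
        rw [mul_pow]
        exact h1.trans (mul_le_mul_of_nonneg_left ih (sq_nonneg _))
      have h3 := minkowski _ _ _ _ (by positivity) (by positivity) h2 (hvar k)
      have h4 : β * (α * D / (1 - β)) + α * D = α * D / (1 - β) := by field_simp; ring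
      rw [h4] at h3
      refine le_trans (le_of_eq ?_) h3
      refine Finset.sum_congr rfl fun i _ => ?_
      congr 2
      rw [hiter, hxb]
      simp only [smul_sub, Finset.sum_sub_distrib, ← Finset.sum_smul, hWrow, one_smul]
      abel
  intro k
  have hdesc : fbar (xbar (k + 1)) ≤ fbar (xbar k) + inner ℝ (gbar k) (-(α • G k))
      + Lfbar / 2 * ‖-(α • G k)‖ ^ 2 := by
    rw [hxb, sub_eq_add_neg, hfbar, hfbar, hgbar, hLfbar, real_inner_smul_left, sum_inner]
    have h1 : ∑ i, f i (xbar k + -(α • G k)) ≤ ∑ i, f i (xbar k)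
        + ∑ i, inner ℝ (gf i (xbar k)) (-(α • G k)) + (∑ i, Lf i) / 2 * ‖-(α • G k)‖ ^ 2 := by
      rw [Finset.sum_div, Finset.sum_mul, ← Finset.sum_add_distrib, ← Finset.sum_add_distrib]
      exact Finset.sum_le_sum fun i _ => descent (f i) (gf i) (Lf i) (hgrad i) (hlipR i) _ _
    have h2 := mul_le_mul_of_nonneg_left h1 (inv_nonneg.2 hnpos.le)
    refine h2.trans (le_of_eq ?_)
    ring
  rw [inner_neg_right, real_inner_smul_right, norm_neg, norm_smul, mul_pow,
    Real.norm_of_nonneg hα.le] at hdesc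
  have hdiff : ‖gbar k - G k‖ ^ 2 ≤ Lh ^ 2 * (α * D / (1 - β)) ^ 2 := by
    have h1 : gbar k - G k = (n : ℝ)⁻¹ • ∑ i, (gf i (xbar k) - gf i (x k i)) := by
      rw [hgbar, Finset.sum_sub_distrib, smul_sub]
    have h2 : ‖∑ i, (gf i (xbar k) - gf i (x k i))‖ ≤ ∑ i, Lh * ‖x k i - xbar k‖ := by
      refine (norm_sum_le _ _).trans (Finset.sum_le_sum fun i _ => ?_)
      rw [norm_sub_rev (x k i)]
      exact hlipH i _ _
    have h3 : (∑ i, Lh * ‖x k i - xbar k‖) ^ 2 ≤ n * (Lh ^ 2 * (α * D / (1 - β)) ^ 2) := by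
      refine sq_sum_le_card_mul_sum_sq.trans ?_
      have e : ∑ i, (Lh * ‖x k i - xbar k‖) ^ 2 = Lh ^ 2 * ∑ i, ‖x k i - xbar k‖ ^ 2 := by
        rw [Finset.mul_sum]
        exact Finset.sum_congr rfl fun i _ => mul_pow _ _ _
      rw [e, Finset.card_univ, Fintype.card_fin]
      exact mul_le_mul_of_nonneg_left
        (mul_le_mul_of_nonneg_left (hdev k) (sq_nonneg _)) hnpos.le
    have h4 := (pow_le_pow_left₀ (norm_nonneg _) h2 2).trans h3
    have hP : 0 ≤ Lh ^ 2 * (α * D / (1 - β)) ^ 2 := by positivity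
    rw [h1, norm_smul, mul_pow, Real.norm_of_nonneg (inv_nonneg.2 hnpos.le)]
    have hn1 : (1 : ℝ) ≤ n := by exact_mod_cast hn
    have h5 : (n : ℝ)⁻¹ ^ 2 * (n * (Lh ^ 2 * (α * D / (1 - β)) ^ 2)) =
        (n : ℝ)⁻¹ * (Lh ^ 2 * (α * D / (1 - β)) ^ 2) := by
      rw [← mul_assoc]; congr 1; field_simp
    calc _ ≤ (n : ℝ)⁻¹ ^ 2 * (n * (Lh ^ 2 * (α * D / (1 - β)) ^ 2)) :=
          mul_le_mul_of_nonneg_left h4 (sq_nonneg _)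
      _ = _ := h5
      _ ≤ _ := mul_le_of_le_one_left hP (inv_le_one_of_one_le₀ hn1)
  rw [norm_sub_sq_real] at hdiff
  rw [hrbar, hrbar]
  have h6 : α ^ 3 * D ^ 2 * Lh ^ 2 / (2 * (1 - β) ^ 2) =
      α / 2 * (Lh ^ 2 * (α * D / (1 - β)) ^ 2) := by field_simp
  rw [h6]
  have h7 := mul_le_mul_of_nonneg_left hdiff (show 0 ≤ α / 2 by positivity)
  have h8 : Lfbar / 2 * (α ^ 2 * ‖G k‖ ^ 2) ≤ α / 2 * ‖G k‖ ^ 2 := by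
    have : 0 ≤ α / 2 * ‖G k‖ ^ 2 := by positivity
    have := mul_le_mul_of_nonneg_left hs2 this
    linarith
  linarith
end
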